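/- arXiv:2102.07078 — 2 statements merged into one kernel-verified Lean document; each statement's English description precedes it below -/
import Mathlib

section
/- Let n, d, N, k be positive integers with k ≤ min(n,d), and let 𝒜 : ℝ^{n×d} → ℝ^N be a linear map satisfying the 2k-restricted isometry property with constant δ_{2k} ∈ [0,1). Let Ŵ* ∈ ℝ^{n×k} have orthonormal columns, let Σ* be a k×k real matrix, and let B̂*, B̂_t ∈ ℝ^{d×k} each have orthonormal columns. Suppose W ∈ ℝ^{n×k} satisfies the least-squares optimality property ‖𝒜(W B̂_tᵀ − Ŵ* Σ* B̂*ᵀ)‖₂ ≤ ‖𝒜(Ŵ* Σ* B̂*ᵀ B̂_t B̂_tᵀ − Ŵ* Σ* B̂*ᵀ)‖₂. Then ‖W B̂_tᵀ − Ŵ* Σ* B̂*ᵀ‖_F ≤ √k · ((1+δ_{2k})/(1−δ_{2k})) · ‖Σ*‖₂ · dist(B̂_t, B̂*). -/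
open Matrix MeasureTheory ProbabilityTheory
open scoped RealInnerProductSpace BigOperators

/-- Frobenius norm of a real matrix. -/
noncomputable def frobNorm {m n : ℕ} (M : Matrix (Fin m) (Fin n) ℝ) : ℝ :=
  Real.sqrt (∑ i, ∑ j, M i j ^ 2)

/-- Spectral (ℓ²-operator) norm of a real matrix. -/
noncomputable def specNorm {m n : ℕ} (M : Matrix (Fin m) (Fin n) ℝ) : ℝ :=
  ‖LinearMap.toContinuousLinearMap (Matrix.toEuclideanLin M)‖

/-- Principal-angle distance between the column spans of two `d × k` matrices
with orthonormal columns: `dist(B, B*) = ‖B*ᵀ (B Bᵀ - I)‖₂`. -/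
noncomputable def pdist {d k : ℕ} (B Bstar : Matrix (Fin d) (Fin k) ℝ) : ℝ :=
  specNorm (Bstarᵀ * (B * Bᵀ - 1))

/-- The `k`-restricted isometry property with constant `δ` for a linear map from
`n × d` matrices to `ℝ^N`. -/
def RIP {n d N : ℕ} (A : Matrix (Fin n) (Fin d) ℝ →ₗ[ℝ] EuclideanSpace ℝ (Fin N))
    (k : ℕ) (δ : ℝ) : Prop :=
  ∀ M : Matrix (Fin n) (Fin d) ℝ, M.rank ≤ k →
    (1 - δ) * frobNorm M ^ 2 ≤ ‖A M‖ ^ 2 ∧ ‖A M‖ ^ 2 ≤ (1 + δ) * frobNorm M ^ 2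

lemma frobNorm_nonneg' {m n : ℕ} (M : Matrix (Fin m) (Fin n) ℝ) : 0 ≤ frobNorm M :=
  Real.sqrt_nonneg _

lemma frobNorm_sq {m n : ℕ} (M : Matrix (Fin m) (Fin n) ℝ) :
    frobNorm M ^ 2 = ∑ i, ∑ j, M i j ^ 2 :=
  Real.sq_sqrt (Finset.sum_nonneg fun i _ => Finset.sum_nonneg fun j _ => sq_nonneg _)

lemma frobNorm_sq_trace {m n : ℕ} (M : Matrix (Fin m) (Fin n) ℝ) :
    frobNorm M ^ 2 = (Mᵀ * M).trace := by
  rw [frobNorm_sq, Finset.sum_comm]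
  simp [Matrix.trace, Matrix.mul_apply, sq]

lemma frobNorm_orth {m n k : ℕ} (U : Matrix (Fin m) (Fin k) ℝ) (hU : Uᵀ * U = 1)
    (M : Matrix (Fin k) (Fin n) ℝ) : frobNorm (U * M) ^ 2 = frobNorm M ^ 2 := by
  rw [frobNorm_sq_trace, frobNorm_sq_trace, Matrix.transpose_mul, Matrix.mul_assoc,
    ← Matrix.mul_assoc Uᵀ, hU, Matrix.one_mul]

lemma specNorm_nonneg' {m n : ℕ} (M : Matrix (Fin m) (Fin n) ℝ) : 0 ≤ specNorm M :=
  norm_nonneg _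

lemma specNorm_mul {m n k : ℕ} (M : Matrix (Fin m) (Fin k) ℝ) (L : Matrix (Fin k) (Fin n) ℝ) :
    specNorm (M * L) ≤ specNorm M * specNorm L := by
  unfold specNorm
  have h : LinearMap.toContinuousLinearMap (Matrix.toEuclideanLin (M * L)) =
      (LinearMap.toContinuousLinearMap (Matrix.toEuclideanLin M)).comp
        (LinearMap.toContinuousLinearMap (Matrix.toEuclideanLin L)) := by
    ext x i
    simp [Matrix.toEuclideanLin, Matrix.toLpLin_apply, Matrix.mulVec_mulVec]
  rw [h]
  exact ContinuousLinearMap.opNorm_comp_le _ _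

lemma row_le {m n : ℕ} (M : Matrix (Fin m) (Fin n) ℝ) (i : Fin m) :
    ∑ j, M i j ^ 2 ≤ specNorm M ^ 2 := by
  let x : EuclideanSpace ℝ (Fin n) := WithLp.toLp 2 (M i)
  have hx : ‖x‖ ^ 2 = ∑ j, M i j ^ 2 := by
    rw [EuclideanSpace.norm_sq_eq]; simp [x]
  have h1 := (LinearMap.toContinuousLinearMap (Matrix.toEuclideanLin M)).le_opNorm x
  have h2 := PiLp.norm_apply_le (Matrix.toEuclideanLin M x) i
  have h3 : (Matrix.toEuclideanLin M x) i = ‖x‖ ^ 2 := by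
    rw [hx]
    simp [Matrix.toEuclideanLin, Matrix.toLpLin_apply, x, Matrix.mulVec, dotProduct, sq]
  rw [h3, Real.norm_eq_abs, abs_of_nonneg (sq_nonneg _)] at h2
  have h4 : ‖x‖ ^ 2 ≤ specNorm M * ‖x‖ := h2.trans h1
  rw [← hx]
  nlinarith [norm_nonneg x, specNorm_nonneg' M, sq_nonneg (specNorm M - ‖x‖)]

lemma frobNorm_le_spec {m n : ℕ} (M : Matrix (Fin m) (Fin n) ℝ) :
    frobNorm M ^ 2 ≤ m * specNorm M ^ 2 := by
  rw [frobNorm_sq]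
  refine (Finset.sum_le_sum fun i _ => row_le M i).trans ?_
  simp

lemma rank_aux {n d k : ℕ} (U V : Matrix (Fin n) (Fin k) ℝ) (B C : Matrix (Fin d) (Fin k) ℝ) :
    (U * Bᵀ - V * Cᵀ).rank ≤ 2 * k := by
  have h : U * Bᵀ - V * Cᵀ = Matrix.fromCols U (-V) * Matrix.fromRows Bᵀ Cᵀ := by
    rw [Matrix.fromCols_mul_fromRows, Matrix.neg_mul, sub_eq_add_neg]
  rw [h]
  refine (Matrix.rank_mul_le_left _ _).trans ((Matrix.rank_le_card_width _).trans ?_)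
  simp [two_mul]

theorem stmt3 {n d N k : ℕ} (hn : 0 < n) (hd : 0 < d) (hN : 0 < N) (hk : 0 < k)
    (hkn : k ≤ n) (hkd : k ≤ d)
    (A : Matrix (Fin n) (Fin d) ℝ →ₗ[ℝ] EuclideanSpace ℝ (Fin N))
    (δ : ℝ) (hδ0 : 0 ≤ δ) (hδ1 : δ < 1) (hRIP : RIP A (2 * k) δ)
    (Wstar : Matrix (Fin n) (Fin k) ℝ) (hWstar : Wstarᵀ * Wstar = 1)
    (Sig : Matrix (Fin k) (Fin k) ℝ)
    (Bstar Bt : Matrix (Fin d) (Fin k) ℝ)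
    (hBstar : Bstarᵀ * Bstar = 1) (hBt : Btᵀ * Bt = 1)
    (W : Matrix (Fin n) (Fin k) ℝ)
    (hls : ‖A (W * Btᵀ - Wstar * Sig * Bstarᵀ)‖ ≤
      ‖A (Wstar * Sig * Bstarᵀ * Bt * Btᵀ - Wstar * Sig * Bstarᵀ)‖) :
    frobNorm (W * Btᵀ - Wstar * Sig * Bstarᵀ) ≤
      Real.sqrt k * ((1 + δ) / (1 - δ)) * specNorm Sig * pdist Bt Bstar := by
  have hX := (hRIP (W * Btᵀ - Wstar * Sig * Bstarᵀ) (rank_aux _ _ _ _)).1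
  have hY := (hRIP (Wstar * Sig * Bstarᵀ * Bt * Btᵀ - Wstar * Sig * Bstarᵀ)
    (rank_aux _ _ _ _)).2
  have hYe : Wstar * Sig * Bstarᵀ * Bt * Btᵀ - Wstar * Sig * Bstarᵀ
      = Wstar * (Sig * (Bstarᵀ * (Bt * Btᵀ - 1))) := by
    simp only [Matrix.mul_sub, Matrix.mul_one, Matrix.mul_assoc]
  have hYF : frobNorm (Wstar * Sig * Bstarᵀ * Bt * Btᵀ - Wstar * Sig * Bstarᵀ) ^ 2
      ≤ k * (specNorm Sig * pdist Bt Bstar) ^ 2 := by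
    rw [hYe, frobNorm_orth _ hWstar]
    refine (frobNorm_le_spec _).trans ?_
    have := specNorm_mul Sig (Bstarᵀ * (Bt * Btᵀ - 1))
    have h0 := specNorm_nonneg' (Sig * (Bstarᵀ * (Bt * Btᵀ - 1)))
    unfold pdist
    gcongr
  have hsq := pow_le_pow_left₀ (norm_nonneg _) hls 2
  have hpd : 0 ≤ pdist Bt Bstar := specNorm_nonneg' _
  have hS := specNorm_nonneg' Sig
  have h1 : 0 < 1 - δ := by linarith
  set r := (1 + δ) / (1 - δ) with hr
  have hr1 : 1 ≤ r := by rw [hr, le_div_iff₀ h1]; linarith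
  have hrm : (1 - δ) * r = 1 + δ := by rw [hr]; field_simp
  set q : ℝ := k * (specNorm Sig * pdist Bt Bstar) ^ 2 with hq
  have hq0 : 0 ≤ q := by positivity
  have key : frobNorm (W * Btᵀ - Wstar * Sig * Bstarᵀ) ^ 2 ≤ r * q := by
    refine le_of_mul_le_mul_left ?_ h1
    rw [← mul_assoc, hrm]
    have := mul_le_mul_of_nonneg_left hYF (show 0 ≤ 1 + δ by linarith)
    linarith
  refine (sq_le_sq₀ (frobNorm_nonneg' _) (by positivity)).1 ?_
  have e : (Real.sqrt k * r * specNorm Sig * pdist Bt Bstar) ^ 2 = r * (r * q) := by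
    have := Real.sq_sqrt (Nat.cast_nonneg (α := ℝ) k)
    rw [hq]
    calc _ = (Real.sqrt k) ^ 2 * (r * (r * (specNorm Sig * pdist Bt Bstar) ^ 2)) := by ring
      _ = _ := by rw [this]; ring
  rw [e]
  have : 0 ≤ r * q := by positivity
  nlinarith
end

section
/- Let n, d, N, k be positive integers and let 𝒜 : ℝ^{n×d} → ℝ^N be a linear map satisfying the 2k-restricted isometry property with constant δ_{2k} ∈ [0,1). Let B̂*, B̂_t ∈ ℝ^{d×k} each have orthonormal columns, and define the linear operator C : ℝ^{n×k} → ℝ^{n×k} by C(U) := (𝒜*𝒜(U B̂*ᵀ)) B̂_t. Then for every U ∈ ℝ^{n×k}, ‖C(U)‖_F ≤ (1 + √k · δ_{2k}) · ‖U‖_F; that is, the operator norm of C with respect to the Frobenius norm is at most 1 + √k · δ_{2k}. -/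
open Matrix MeasureTheory ProbabilityTheory
open scoped RealInnerProductSpace BigOperators

lemma frob_sq {m n : ℕ} (M : Matrix (Fin m) (Fin n) ℝ) :
    frobNorm M ^ 2 = Matrix.trace (Mᵀ * M) := by
  unfold frobNorm
  have h0 : 0 ≤ ∑ i, ∑ j, M i j ^ 2 :=
    Finset.sum_nonneg fun i _ => Finset.sum_nonneg fun j _ => sq_nonneg _
  refine (Real.sq_sqrt h0).trans ?_
  rw [Finset.sum_comm]
  simp [Matrix.trace, Matrix.mul_apply, sq]

lemma frob_mul {n d k : ℕ} (U : Matrix (Fin n) (Fin k) ℝ) (B : Matrix (Fin d) (Fin k) ℝ)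
    (hB : Bᵀ * B = 1) : frobNorm (U * Bᵀ) = frobNorm U := by
  have h : frobNorm (U * Bᵀ) ^ 2 = frobNorm U ^ 2 := by
    rw [frob_sq, frob_sq, Matrix.transpose_mul, Matrix.transpose_transpose, Matrix.mul_assoc,
      Matrix.trace_mul_comm, Matrix.mul_assoc, Matrix.mul_assoc, hB, Matrix.mul_one]
  exact (sq_eq_sq₀ (Real.sqrt_nonneg _) (Real.sqrt_nonneg _)).1 h

lemma rip_bound {n d N k : ℕ} (A : Matrix (Fin n) (Fin d) ℝ →ₗ[ℝ] EuclideanSpace ℝ (Fin N))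
    (δ : ℝ) (hδ0 : 0 ≤ δ) (hRIP : RIP A (2 * k) δ)
    (U : Matrix (Fin n) (Fin k) ℝ) (B : Matrix (Fin d) (Fin k) ℝ)
    (hB : Bᵀ * B = 1) : ‖A (U * Bᵀ)‖ ≤ Real.sqrt (1 + δ) * frobNorm U := by
  have hr : (U * Bᵀ).rank ≤ 2 * k := by
    have h1 := Matrix.rank_mul_le_left U Bᵀ
    have h2 := Matrix.rank_le_width U
    omega
  have h := (hRIP _ hr).2
  rw [frob_mul U B hB] at h
  refine (pow_le_pow_iff_left₀ (norm_nonneg _) (mul_nonneg (Real.sqrt_nonneg _) (Real.sqrt_nonneg _))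
    two_ne_zero).1 ?_
  rw [mul_pow, Real.sq_sqrt (by linarith)]
  exact h

theorem stmt4 {n d N k : ℕ} (hn : 0 < n) (hd : 0 < d) (hN : 0 < N) (hk : 0 < k)
    (A : Matrix (Fin n) (Fin d) ℝ →ₗ[ℝ] EuclideanSpace ℝ (Fin N))
    (Astar : EuclideanSpace ℝ (Fin N) →ₗ[ℝ] Matrix (Fin n) (Fin d) ℝ)
    (hadj : ∀ (M : Matrix (Fin n) (Fin d) ℝ) (y : EuclideanSpace ℝ (Fin N)),
      ⟪A M, y⟫ = Matrix.trace (Mᵀ * Astar y))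
    (δ : ℝ) (hδ0 : 0 ≤ δ) (hδ1 : δ < 1) (hRIP : RIP A (2 * k) δ)
    (Bstar Bt : Matrix (Fin d) (Fin k) ℝ)
    (hBstar : Bstarᵀ * Bstar = 1) (hBt : Btᵀ * Bt = 1) :
    ∀ U : Matrix (Fin n) (Fin k) ℝ,
      frobNorm ((Astar (A (U * Bstarᵀ))) * Bt) ≤ (1 + Real.sqrt k * δ) * frobNorm U := by
  intro U
  set W := (Astar (A (U * Bstarᵀ))) * Bt with hW
  have h1 : frobNorm W ^ 2 = ⟪A (W * Btᵀ), A (U * Bstarᵀ)⟫ := by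
    have e : (W * Btᵀ)ᵀ = Bt * Wᵀ := by
      rw [Matrix.transpose_mul, Matrix.transpose_transpose]
    rw [hadj, frob_sq, e, Matrix.mul_assoc, Matrix.trace_mul_comm Bt, Matrix.mul_assoc, ← hW]
  have h2 := real_inner_le_norm (A (W * Btᵀ)) (A (U * Bstarᵀ))
  have h3 := rip_bound A δ hδ0 hRIP W Bt hBt
  have h4 := rip_bound A δ hδ0 hRIP U Bstar hBstar
  have hWn : 0 ≤ frobNorm W := Real.sqrt_nonneg _
  have hUn : 0 ≤ frobNorm U := Real.sqrt_nonneg _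
  have h5 := mul_le_mul h3 h4 (norm_nonneg _) (mul_nonneg (Real.sqrt_nonneg _) hWn)
  have hs : Real.sqrt (1 + δ) * Real.sqrt (1 + δ) = 1 + δ := Real.mul_self_sqrt (by linarith)
  have h6 : frobNorm W * frobNorm W ≤ frobNorm W * ((1 + δ) * frobNorm U) := by
    calc frobNorm W * frobNorm W = frobNorm W ^ 2 := by ring
      _ ≤ Real.sqrt (1 + δ) * frobNorm W * (Real.sqrt (1 + δ) * frobNorm U) :=
        h1.le.trans (h2.trans h5)
      _ = frobNorm W * ((Real.sqrt (1 + δ) * Real.sqrt (1 + δ)) * frobNorm U) := by ring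
      _ = _ := by rw [hs]
  have h7 : frobNorm W ≤ (1 + δ) * frobNorm U := by
    rcases hWn.eq_or_lt with h | h
    · rw [← h]; exact mul_nonneg (by linarith) hUn
    · exact le_of_mul_le_mul_left h6 h
  have hk1 : (1 : ℝ) ≤ Real.sqrt k := Real.one_le_sqrt.2 (by exact_mod_cast hk)
  refine h7.trans (mul_le_mul_of_nonneg_right ?_ hUn)
  nlinarith
end
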